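/- Let A be a two-player game arena with position set Pos and let T be an attack tree with n leaves. If the strategy semantics [[T]]^strat of T over A is nonempty, then it contains an s-tree of depth d ≤ |Pos| × n. -/

import Mathlib

/-! ### Words, merge, synchronized concatenation, s-trees -/

/-- The merge of two sets of words:
`P ⋈ Q = {p ∈ P : ∃ q ∈ Q, q ≼ p} ∪ {q ∈ Q : ∃ p ∈ P, p ≼ q}`. -/
def merge {α : Type*} (P Q : Set (List α)) : Set (List α) :=
  {p | p ∈ P ∧ ∃ q ∈ Q, q <+: p} ∪ {q | q ∈ Q ∧ ∃ p ∈ P, p <+: q}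

/-- Synchronized concatenation, lifted to sets of words: `π ⊙ π'` is defined when the
last letter of `π` equals the first letter of `π'` and concatenates `π` with the tail of `π'`. -/
def sconcat {α : Type*} (P Q : Set (List α)) : Set (List α) :=
  {w | ∃ p ∈ P, ∃ q ∈ Q, p.getLast? = q.head? ∧ w = p ++ q.tail}

/-- An s-tree over an alphabet `α`: a nonempty set of nonempty words, closed under
nonempty prefixes, all words having the same first letter (the root). -/
def IsSTree {α : Type*} (S : Set (List α)) : Prop :=
  S.Nonempty ∧ (∀ w ∈ S, w ≠ []) ∧
  (∀ w ∈ S, ∀ w' : List α, w' <+: w → w' ≠ [] → w' ∈ S) ∧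
  (∃ a, ∀ w ∈ S, w.head? = some a)

/-- A leaf of an s-tree: a word with no proper extension in the tree. -/
def IsLeafOf {α : Type*} (S : Set (List α)) (w : List α) : Prop :=
  w ∈ S ∧ ∀ w' ∈ S, w <+: w' → w' = w

/-- The children of `w` in `S`: its minimal proper extensions in `S`. -/
def childrenOf {α : Type*} (S : Set (List α)) (w : List α) : Set (List α) :=
  {w' | w' ∈ S ∧ w <+: w' ∧ w' ≠ w ∧
    ∀ w'' ∈ S, w <+: w'' → w'' <+: w' → w'' = w ∨ w'' = w'}

/-- `S'` is a prefix of the s-tree `S`: `S'` is an s-tree with the same root,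
`S' ⊆ S`, and every non-leaf of `S'` has the same children in `S'` as in `S`. -/
def TreePrefix {α : Type*} (S' S : Set (List α)) : Prop :=
  IsSTree S' ∧ (∃ a, [a] ∈ S' ∧ [a] ∈ S) ∧ S' ⊆ S ∧
  ∀ w ∈ S', ¬ IsLeafOf S' w → childrenOf S' w = childrenOf S w

/-! ### Transition systems and attack trees -/

/-- A transition system over propositions `π` with states `σ`. -/
structure TSys (σ π : Type*) where
  step : σ → σ → Prop
  val : σ → Set π

/-- A path of a transition system: a nonempty finite sequence of states related by `step`. -/
def IsTPath {σ π : Type*} (T : TSys σ π) (w : List σ) : Prop :=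
  w ≠ [] ∧ List.Chain' T.step w

/-- Attack trees: a leaf is a Boolean formula, identified with the set of states where
it holds; inner nodes are `OR`, `SAND` and `AND` operators. -/
inductive ATree (σ : Type*) where
  | leaf (F : Set σ)
  | or (t₁ t₂ : ATree σ)
  | sand (t₁ t₂ : ATree σ)
  | and (t₁ t₂ : ATree σ)

/-- The number of leaves of an attack tree. -/
def numLeaves {σ : Type*} : ATree σ → ℕ
  | .leaf _ => 1
  | .or t₁ t₂ => numLeaves t₁ + numLeaves t₂
  | .sand t₁ t₂ => numLeaves t₁ + numLeaves t₂
  | .and t₁ t₂ => numLeaves t₁ + numLeaves t₂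

/-- The path semantics of an attack tree over a transition system. -/
def pathSem {σ π : Type*} (T : TSys σ π) : ATree σ → Set (List σ)
  | .leaf F => {w | IsTPath T w ∧ ∃ s ∈ F, w.getLast? = some s}
  | .or t₁ t₂ => pathSem T t₁ ∪ pathSem T t₂
  | .sand t₁ t₂ => sconcat (pathSem T t₁) (pathSem T t₂)
  | .and t₁ t₂ => merge (pathSem T t₁) (pathSem T t₂)

/-! ### Two-player game arenas -/

/-- A two-player concurrent game arena: a total transition function on positions given
joint actions of the two players, and a valuation of positions by atomic propositions. -/
structure Arena (Pos Act₁ Act₂ Prp : Type*) where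
  delta : Pos → Act₁ × Act₂ → Pos
  val : Pos → Set Prp

variable {Pos Act₁ Act₂ Prp : Type*}

/-- A play: an infinite sequence of positions, each next one reached by some joint action. -/
def IsPlay (A : Arena Pos Act₁ Act₂ Prp) (ρ : ℕ → Pos) : Prop :=
  ∀ i : ℕ, ∃ a : Act₁ × Act₂, ρ (i + 1) = A.delta (ρ i) a

/-- The prefix of length `n` of a play. -/
def playPrefix (ρ : ℕ → Pos) (n : ℕ) : List Pos :=
  (List.range n).map ρ

/-- Consistency of a history with a strategy `σ` of the player whose actions are extracted
from joint actions by `proj` (`Prod.fst` for Player 1/Attacker, `Prod.snd` for Player 2). -/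
def ConsistHist {Act : Type*} (A : Arena Pos Act₁ Act₂ Prp) (proj : Act₁ × Act₂ → Act)
    (σ : List Pos → Act) (w : List Pos) : Prop :=
  ∀ (j : ℕ) (h : j + 1 < w.length),
    ∃ a : Act₁ × Act₂,
      A.delta (w[j]'(Nat.lt_of_succ_lt h)) a = w[j + 1]'h ∧ proj a = σ (w.take (j + 1))

/-- A play is consistent with a strategy if all its nonempty finite prefixes are. -/
def ConsistPlay {Act : Type*} (A : Arena Pos Act₁ Act₂ Prp) (proj : Act₁ × Act₂ → Act)
    (σ : List Pos → Act) (ρ : ℕ → Pos) : Prop :=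
  ∀ n : ℕ, ConsistHist A proj σ (playPrefix ρ n)

/-- A history: a nonempty finite prefix of a play. -/
def IsHist (A : Arena Pos Act₁ Act₂ Prp) (w : List Pos) : Prop :=
  ∃ ρ, IsPlay A ρ ∧ ∃ n, 1 ≤ n ∧ w = playPrefix ρ n

/-- `Hist A v`: the histories starting at position `v`. -/
def Hist (A : Arena Pos Act₁ Act₂ Prp) (v : Pos) : Set (List Pos) :=
  {w | ∃ ρ, IsPlay A ρ ∧ ρ 0 = v ∧ ∃ n, 1 ≤ n ∧ w = playPrefix ρ n}

/-- `Prefixes(Out(σ))`: nonempty finite prefixes of plays consistent with `σ`. -/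
def PrefixesOut {Act : Type*} (A : Arena Pos Act₁ Act₂ Prp) (proj : Act₁ × Act₂ → Act)
    (σ : List Pos → Act) : Set (List Pos) :=
  {w | ∃ ρ, IsPlay A ρ ∧ ConsistPlay A proj σ ρ ∧ ∃ n, 1 ≤ n ∧ w = playPrefix ρ n}

/-- The s-tree associated with a strategy `σ` from position `v`:
`S^σ_v = Prefixes(Out(σ)) ∩ Hist(A, v)`. -/
def STree {Act : Type*} (A : Arena Pos Act₁ Act₂ Prp) (proj : Act₁ × Act₂ → Act)
    (σ : List Pos → Act) (v : Pos) : Set (List Pos) :=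
  PrefixesOut A proj σ ∩ Hist A v

/-- The transition system induced by a game arena: `(v, v')` is a transition iff
`δ(v, a) = v'` for some joint action `a`. -/
def arenaTS (A : Arena Pos Act₁ Act₂ Prp) : TSys Pos Prp :=
  ⟨fun v v' => ∃ a : Act₁ × Act₂, A.delta v a = v', A.val⟩

/-- An Attacker strategy is winning for the reachability game `(A, R)` from `v` if every
play consistent with it starting at `v` visits a position of `R`. -/
def WinningFrom (A : Arena Pos Act₁ Act₂ Prp) (σ : List Pos → Act₁) (v : Pos)
    (R : Set Pos) : Prop :=
  ∀ ρ : ℕ → Pos, IsPlay A ρ → ConsistPlay A Prod.fst σ ρ → ρ 0 = v → ∃ i, ρ i ∈ R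

/-- A witness of an Attacker strategy `σ` from `v` for the reachability set `R`:
a finite prefix of `S^σ_v` all of whose leaves end in a position of `R`. -/
def Witness (A : Arena Pos Act₁ Act₂ Prp) (σ : List Pos → Act₁) (v : Pos) (R : Set Pos)
    (S : Set (List Pos)) : Prop :=
  S.Finite ∧ TreePrefix S (STree A Prod.fst σ v) ∧
  ∀ w, IsLeafOf S w → ∃ p ∈ R, w.getLast? = some p

/-- An s-tree over `Pos` is well-formed if it is a prefix of `S^σ_v` for some Attacker
strategy `σ` and position `v`. -/
def WellFormed (A : Arena Pos Act₁ Act₂ Prp) (S : Set (List Pos)) : Prop :=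
  ∃ (σ : List Pos → Act₁) (v : Pos), TreePrefix S (STree A Prod.fst σ v)

/-- The strategy semantics of an attack tree `t` over the arena `A`: the set of all
well-formed `t`-s-trees, i.e. well-formed finite s-trees all of whose leaves belong to
the path semantics of `t` over the transition system induced by `A`. -/
def stratSem (A : Arena Pos Act₁ Act₂ Prp) (t : ATree Pos) : Set (Set (List Pos)) :=
  {S | WellFormed A S ∧ S.Finite ∧ IsSTree S ∧
    ∀ w, IsLeafOf S w → w ∈ pathSem (arenaTS A) t}

/-! ### Residuals of attack trees -/

namespace ATree

variable {α : Type*}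

open Classical in
/-- The residual of an attack tree after visiting the state `v`, stopping at the earliest
possible completion: `none` means that the tree has been completed. -/
noncomputable def feed (v : α) : ATree α → Option (ATree α)
  | .leaf F => if v ∈ F then none else some (.leaf F)
  | .or t₁ t₂ => match feed v t₁, feed v t₂ with
    | some s₁, some s₂ => some (.or s₁ s₂)
    | _, _ => none
  | .sand t₁ t₂ => match feed v t₁ with
    | some s₁ => some (.sand s₁ t₂)
    | none => feed v t₂
  | .and t₁ t₂ => match feed v t₁, feed v t₂ with
    | some s₁, some s₂ => some (.and s₁ s₂)
    | some s₁, none => some s₁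
    | none, r => r

/-- The residual of an attack tree after visiting the states of a word. -/
noncomputable def run : ATree α → List α → Option (ATree α)
  | t, [] => some t
  | t, v :: w => match feed v t with
    | some s => run s w
    | none => none

theorem run_nil (t : ATree α) : run t [] = some t := by
  simp [run]

theorem run_cons_of_feed_none {t : ATree α} {v : α} (h : feed v t = none) (w : List α) :
    run t (v :: w) = none := by
  simp [run, h]

theorem run_cons_of_feed_some {t s : ATree α} {v : α} (h : feed v t = some s) (w : List α) :
    run t (v :: w) = run s w := by
  simp [run, h]

theorem run_singleton (t : ATree α) (v : α) : run t [v] = feed v t := by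
  rcases h : feed v t with _ | s
  · exact run_cons_of_feed_none h _
  · rw [run_cons_of_feed_some h, run_nil]

theorem run_append (t : ATree α) (u w : List α) :
    run t (u ++ w) = (run t u).bind fun s => run s w := by
  induction u generalizing t with
  | nil => simp [run_nil]
  | cons v u ih =>
    rcases h : feed v t with _ | s
    · simp [run_cons_of_feed_none h]
    · simp [run_cons_of_feed_some h, ih]

theorem run_append_of_some {t s : ATree α} {u : List α} (h : run t u = some s) (w : List α) :
    run t (u ++ w) = run s w := by
  simp [run_append, h]

theorem run_eq_none_of_isPrefix {t : ATree α} {u w : List α} (h : run t u = none)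
    (huw : u <+: w) : run t w = none := by
  obtain ⟨r, rfl⟩ := huw
  simp [run_append, h]

/-- A completed run has a shortest completed initial segment. -/
theorem exists_first_completion {t : ATree α} {w : List α} (h : run t w = none) :
    ∃ u x r, w = u ++ x :: r ∧ run t u ≠ none ∧ run t (u ++ [x]) = none := by
  induction w generalizing t with
  | nil => simp [run_nil] at h
  | cons v w ih =>
    rcases hv : feed v t with _ | s
    · exact ⟨[], v, w, rfl, by simp [run_nil], by simpa [run_singleton] using hv⟩
    · rw [run_cons_of_feed_some hv] at h
      obtain ⟨u, x, r, rfl, h₁, h₂⟩ := ih h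
      refine ⟨v :: u, x, r, rfl, ?_, ?_⟩
      · rwa [run_cons_of_feed_some hv]
      · rwa [List.cons_append, run_cons_of_feed_some hv]

theorem run_leaf_eq_none_iff (F : Set α) (w : List α) :
    run (.leaf F) w = none ↔ ∃ x ∈ w, x ∈ F := by
  induction w with
  | nil => simp [run_nil]
  | cons v w ih =>
    by_cases hv : v ∈ F
    · simp [run, feed, hv]
    · simp [run, feed, hv, ih]

theorem run_or_eq_none_iff (t₁ t₂ : ATree α) (w : List α) :
    run (.or t₁ t₂) w = none ↔ run t₁ w = none ∨ run t₂ w = none := by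
  induction w generalizing t₁ t₂ with
  | nil => simp [run_nil]
  | cons v w ih =>
    rcases h₁ : feed v t₁ with _ | s₁ <;> rcases h₂ : feed v t₂ with _ | s₂ <;>
      simp [run, feed, h₁, h₂, ih]

theorem run_and_eq_none_iff (t₁ t₂ : ATree α) (w : List α) :
    run (.and t₁ t₂) w = none ↔ run t₁ w = none ∧ run t₂ w = none := by
  induction w generalizing t₁ t₂ with
  | nil => simp [run_nil]
  | cons v w ih =>
    rcases h₁ : feed v t₁ with _ | s₁ <;> rcases h₂ : feed v t₂ with _ | s₂ <;>
      simp [run, feed, h₁, h₂, ih]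

theorem exists_split_of_run_sand_eq_none {t₁ t₂ : ATree α} {w : List α}
    (h : run (.sand t₁ t₂) w = none) :
    ∃ u x r, w = u ++ x :: r ∧ run t₁ u ≠ none ∧ run t₁ (u ++ [x]) = none ∧
      run t₂ (x :: r) = none := by
  induction w generalizing t₁ with
  | nil => simp [run_nil] at h
  | cons v w ih =>
    rcases hv : feed v t₁ with _ | s
    · refine ⟨[], v, w, rfl, by simp [run_nil], by simpa [run_singleton] using hv, ?_⟩
      simpa [run, feed, hv] using h
    · have hs : feed v (.sand t₁ t₂) = some (.sand s t₂) := by simp [feed, hv]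
      rw [run_cons_of_feed_some hs] at h
      obtain ⟨u, x, r, rfl, h₁, h₂, h₃⟩ := ih h
      refine ⟨v :: u, x, r, rfl, ?_, ?_, h₃⟩
      · rwa [run_cons_of_feed_some hv]
      · rwa [List.cons_append, run_cons_of_feed_some hv]

theorem run_sand_eq_none_aux {t₁ t₂ : ATree α}
    (hext : ∀ (v : α) (w : List α), run t₂ w = none → run t₂ (v :: w) = none)
    {u r : List α} {x : α} (h₁ : run t₁ (u ++ [x]) = none) (h₂ : run t₂ (x :: r) = none) :
    run (.sand t₁ t₂) (u ++ x :: r) = none := by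
  have hexts (u w : List α) (h : run t₂ w = none) : run t₂ (u ++ w) = none := by
    induction u with
    | nil => exact h
    | cons v u ih => exact hext v _ ih
  induction u generalizing t₁ with
  | nil =>
    rw [List.nil_append, run_singleton] at h₁
    simpa [run, feed, h₁] using h₂
  | cons v u ih =>
    rcases hv : feed v t₁ with _ | s
    · have := hexts (v :: u) _ h₂
      simpa [run, feed, hv] using this
    · have hs : feed v (.sand t₁ t₂) = some (.sand s t₂) := by simp [feed, hv]
      rw [List.cons_append, run_cons_of_feed_some hs]
      rw [List.cons_append, run_cons_of_feed_some hv] at h₁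
      exact ih h₁

theorem run_cons_eq_none (t : ATree α) (v : α) {w : List α} (h : run t w = none) :
    run t (v :: w) = none := by
  induction t generalizing v w with
  | leaf F =>
    rw [run_leaf_eq_none_iff] at h ⊢
    obtain ⟨x, hx, hF⟩ := h
    exact ⟨x, List.mem_cons_of_mem _ hx, hF⟩
  | or t₁ t₂ ih₁ ih₂ =>
    rw [run_or_eq_none_iff] at h ⊢
    exact h.imp (ih₁ v) (ih₂ v)
  | sand t₁ t₂ ih₁ ih₂ =>
    obtain ⟨u, x, r, rfl, -, h₁, h₂⟩ := exists_split_of_run_sand_eq_none h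
    exact run_sand_eq_none_aux (u := v :: u) (fun v _ => ih₂ v) (ih₁ v h₁) h₂
  | and t₁ t₂ ih₁ ih₂ =>
    rw [run_and_eq_none_iff] at h ⊢
    exact h.imp (ih₁ v) (ih₂ v)

theorem run_sand_eq_none {t₁ t₂ : ATree α} {u r : List α} {x : α}
    (h₁ : run t₁ (u ++ [x]) = none) (h₂ : run t₂ (x :: r) = none) :
    run (.sand t₁ t₂) (u ++ x :: r) = none :=
  run_sand_eq_none_aux (fun v _ => run_cons_eq_none t₂ v) h₁ h₂

theorem ne_nil_of_mem_pathSem {π : Type*} (T : TSys α π) {t : ATree α} {w : List α}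
    (h : w ∈ pathSem T t) : w ≠ [] := by
  induction t generalizing w with
  | leaf F => exact h.1.1
  | or t₁ t₂ ih₁ ih₂ => exact h.elim ih₁ ih₂
  | sand t₁ t₂ ih₁ ih₂ =>
    obtain ⟨p, hp, q, -, -, rfl⟩ := h
    simp [ih₁ hp]
  | and t₁ t₂ ih₁ ih₂ => exact h.elim (fun h => ih₁ h.1) (fun h => ih₂ h.1)

/-- Every word of the path semantics completes the attack tree. -/
theorem run_eq_none_of_mem_pathSem {π : Type*} (T : TSys α π) {t : ATree α} {w : List α}
    (h : w ∈ pathSem T t) : run t w = none := by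
  induction t generalizing w with
  | leaf F =>
    obtain ⟨-, s, hs, hw⟩ := h
    exact (run_leaf_eq_none_iff F w).2 ⟨s, List.mem_of_getLast? hw, hs⟩
  | or t₁ t₂ ih₁ ih₂ => exact (run_or_eq_none_iff _ _ _).2 (h.imp ih₁ ih₂)
  | sand t₁ t₂ ih₁ ih₂ =>
    obtain ⟨p, hp, q, hq, hpq, rfl⟩ := h
    have h₁ := ih₁ hp
    have h₂ := ih₂ hq
    obtain _ | ⟨x, r⟩ := q
    · exact absurd rfl (ne_nil_of_mem_pathSem T hq)
    · obtain ⟨u, rfl⟩ := List.getLast?_eq_some_iff.1 hpq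
      simpa using run_sand_eq_none h₁ h₂
  | and t₁ t₂ ih₁ ih₂ =>
    rw [run_and_eq_none_iff]
    obtain ⟨hp, q, hq, hqp⟩ | ⟨hq, p, hp, hpq⟩ := h
    · exact ⟨ih₁ hp, run_eq_none_of_isPrefix (ih₂ hq) hqp⟩
    · exact ⟨run_eq_none_of_isPrefix (ih₁ hp) hpq, ih₂ hq⟩

/-- A path that completes the attack tree for the first time belongs to its path semantics. -/
theorem mem_pathSem_of_first_completion {π : Type*} (T : TSys α π) {t : ATree α} {w : List α}
    {v : α} (hw : List.IsChain T.step (w ++ [v])) (h₁ : run t w ≠ none)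
    (h₂ : run t (w ++ [v]) = none) : w ++ [v] ∈ pathSem T t := by
  have first {t : ATree α} (ih : ∀ {w : List α} {v : α}, List.IsChain T.step (w ++ [v]) →
      run t w ≠ none → run t (w ++ [v]) = none → w ++ [v] ∈ pathSem T t) {x : List α}
      (hx : List.IsChain T.step x) (h : run t x = none) : ∃ q ∈ pathSem T t, q <+: x := by
    obtain ⟨u, y, r, rfl, h₁, h₂⟩ := exists_first_completion h
    have hpre : u ++ [y] <+: u ++ y :: r := ⟨r, by simp⟩
    exact ⟨u ++ [y], ih (hx.prefix hpre) h₁ h₂, hpre⟩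
  induction t generalizing w v with
  | leaf F =>
    refine ⟨⟨by simp, hw⟩, v, ?_, by simp⟩
    rw [Ne, run_leaf_eq_none_iff] at h₁
    rw [run_leaf_eq_none_iff] at h₂
    obtain ⟨x, hx, hF⟩ := h₂
    obtain hx | hx := List.mem_append.1 hx
    · exact absurd ⟨x, hx, hF⟩ h₁
    · rwa [← List.mem_singleton.1 hx]
  | or t₁ t₂ ih₁ ih₂ =>
    rw [Ne, run_or_eq_none_iff, not_or] at h₁
    rw [run_or_eq_none_iff] at h₂
    exact h₂.imp (ih₁ hw h₁.1) (ih₂ hw h₁.2)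
  | sand t₁ t₂ ih₁ ih₂ =>
    obtain ⟨u, x, r, hr, hu, hux, hxr⟩ := exists_split_of_run_sand_eq_none h₂
    have hsplit : w ++ [v] = (u ++ [x]) ++ r := by simp [hr]
    refine ⟨u ++ [x], ih₁ (hw.prefix ⟨r, hsplit.symm⟩) hu hux, x :: r, ?_, by simp, hsplit⟩
    obtain rfl | ⟨r, y, rfl⟩ := List.eq_nil_or_concat' r
    · exact ih₂ (w := []) (by simp) (by simp [run_nil]) hxr
    · rw [← List.cons_append, ← List.append_assoc] at hr
      obtain ⟨rfl, hy⟩ := List.append_inj' hr rfl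
      refine ih₂ (w := x :: r) ?_ (fun h => h₁ (run_sand_eq_none hux h)) hxr
      exact hw.suffix ⟨u, by simp_all⟩
  | and t₁ t₂ ih₁ ih₂ =>
    rw [Ne, run_and_eq_none_iff, not_and_or] at h₁
    rw [run_and_eq_none_iff] at h₂
    obtain h | h := h₁
    · exact .inl ⟨ih₁ hw h h₂.1, first ih₂ hw h₂.2⟩
    · exact .inr ⟨ih₂ hw h h₂.2, first ih₁ hw h₂.1⟩

theorem numLeaves_pos (t : ATree α) : 0 < numLeaves t := by
  induction t <;> simp only [numLeaves] <;> omega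

/-- A residual that differs from the attack tree has fewer leaves. -/
theorem eq_or_numLeaves_lt_of_feed {t s : ATree α} {v : α} (h : feed v t = some s) :
    s = t ∨ numLeaves s < numLeaves t := by
  induction t generalizing s with
  | leaf F =>
    rw [feed] at h
    split_ifs at h
    exact .inl (Option.some.inj h).symm
  | or t₁ t₂ ih₁ ih₂ =>
    rcases h₁ : feed v t₁ with _ | s₁ <;> rcases h₂ : feed v t₂ with _ | s₂ <;>
      simp only [feed, h₁, h₂, reduceCtorEq, Option.some.injEq] at h
    subst h
    obtain rfl | h₁ := ih₁ h₁ <;> obtain rfl | h₂ := ih₂ h₂ <;> simp [numLeaves] <;> omega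
  | sand t₁ t₂ ih₁ ih₂ =>
    rcases h₁ : feed v t₁ with _ | s₁ <;> simp only [feed, h₁, Option.some.injEq] at h
    · have := numLeaves_pos t₁
      obtain rfl | h₂ := ih₂ h <;> simp only [numLeaves] <;> omega
    · subst h
      obtain rfl | h₁ := ih₁ h₁ <;> simp [numLeaves]
      omega
  | and t₁ t₂ ih₁ ih₂ =>
    have := numLeaves_pos t₁
    have := numLeaves_pos t₂
    rcases h₁ : feed v t₁ with _ | s₁ <;> rcases h₂ : feed v t₂ with _ | s₂ <;>
      simp only [feed, h₁, h₂, reduceCtorEq, Option.some.injEq] at h <;> subst h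
    · obtain rfl | h₂ := ih₂ h₂ <;> simp only [numLeaves] <;> omega
    · obtain rfl | h₁ := ih₁ h₁ <;> simp only [numLeaves] <;> omega
    · obtain rfl | h₁ := ih₁ h₁ <;> obtain rfl | h₂ := ih₂ h₂ <;> simp [numLeaves] <;> omega

end ATree

/-! ### Bounded games for attack trees -/

/-- Attacker can force completion of the attack tree, starting at the given position, within
plays of at most the given number of positions. -/
def WinWithin (A : Arena Pos Act₁ Act₂ Prp) : ℕ → Pos → ATree Pos → Prop
  | 0, _, _ => False
  | k + 1, v, t => ∀ s, t.feed v = some s →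
      ∃ a₁ : Act₁, ∀ a₂ : Act₂, WinWithin A k (A.delta v (a₁, a₂)) s

theorem WinWithin.succ {A : Arena Pos Act₁ Act₂ Prp} {k : ℕ} {v : Pos} {t : ATree Pos}
    (h : WinWithin A k v t) : WinWithin A (k + 1) v t := by
  induction k generalizing v t with
  | zero => exact h.elim
  | succ k ih =>
    intro s hs
    obtain ⟨a₁, ha⟩ := h s hs
    exact ⟨a₁, fun a₂ => ih (ha a₂)⟩

theorem WinWithin.mono {A : Arena Pos Act₁ Act₂ Prp} {k l : ℕ} (hkl : k ≤ l) {v : Pos}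
    {t : ATree Pos} (h : WinWithin A k v t) : WinWithin A l v t := by
  induction hkl with
  | refl => exact h
  | step _ ih => exact ih.succ

theorem Set.subset_card_of_stable {α : Type*} [Fintype α] {Y : ℕ → Set α} (hmono : Monotone Y)
    (hstab : ∀ j, Y j = Y (j + 1) → Y (j + 1) = Y (j + 2)) (k : ℕ) :
    Y k ⊆ Y (Fintype.card α) := by
  have eq_of_ncard {i j : ℕ} (hij : i ≤ j) (h : (Y i).ncard = (Y j).ncard) : Y i = Y j :=
    Set.eq_of_subset_of_ncard_le (hmono hij) h.ge
  obtain hk | hk := le_total k (Fintype.card α)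
  · exact hmono hk
  · refine (eq_of_ncard hk (Nat.stabilises_of_monotone (f := fun j => (Y j).ncard)
      ?_ ?_ ?_ hk).symm).ge
    · exact fun i j hij => Set.ncard_le_ncard (hmono hij)
    · exact fun j => (Set.ncard_le_card _).trans_eq Nat.card_eq_fintype_card
    · exact fun j hj => congrArg Set.ncard (hstab j (eq_of_ncard j.le_succ hj))

/-- A winnable bounded game can be won within `|Pos| * n` positions. -/
theorem WinWithin.card_mul_numLeaves [Fintype Pos] {A : Arena Pos Act₁ Act₂ Prp} {k : ℕ}
    {v : Pos} {t : ATree Pos} (h : WinWithin A k v t) :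
    WinWithin A (Fintype.card Pos * numLeaves t) v t := by
  induction hn : numLeaves t using Nat.strong_induction_on generalizing t v k with
  | _ n ih =>
    subst hn
    obtain ⟨m, hm⟩ : ∃ m, numLeaves t = m + 1 :=
      Nat.exists_eq_succ_of_ne_zero t.numLeaves_pos.ne'
    let Y : ℕ → Set Pos := fun j => {x | WinWithin A (Fintype.card Pos * m + j) x t}
    have key : Y k ⊆ Y (Fintype.card Pos) := by
      refine Set.subset_card_of_stable (fun i j hij x hx => hx.mono (by omega)) ?_ k
      refine fun j hj => Set.Subset.antisymm (fun x hx => hx.succ) fun x hx s hs => ?_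
      obtain ⟨a₁, ha⟩ := hx s hs
      refine ⟨a₁, fun a₂ => ?_⟩
      obtain rfl | hlt := ATree.eq_or_numLeaves_lt_of_feed hs
      · exact hj.ge (ha a₂)
      · refine (ih _ hlt (ha a₂) rfl).mono (Nat.le_add_right_of_le ?_)
        exact Nat.mul_le_mul_left _ (by omega)
    rw [hm, Nat.mul_succ]
    exact key (h.mono (Nat.le_add_left _ _))

/-! ### Histories consistent with a strategy -/

theorem ConsistHist.of_isPrefix {Act : Type*} {A : Arena Pos Act₁ Act₂ Prp}
    {proj : Act₁ × Act₂ → Act} {σ : List Pos → Act} {u w : List Pos}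
    (h : ConsistHist A proj σ w) (huw : u <+: w) : ConsistHist A proj σ u := by
  intro j hj
  have hlen := huw.length_le
  obtain ⟨a, ha, hσ⟩ := h j (by omega)
  obtain ⟨r, rfl⟩ := huw
  refine ⟨a, ?_, ?_⟩
  · simpa [List.getElem_append_left, hj, Nat.lt_of_succ_lt hj] using ha
  · rwa [List.take_append_of_le_length hj.le] at hσ

theorem consistHist_concat_concat_iff {Act : Type*} {A : Arena Pos Act₁ Act₂ Prp}
    {proj : Act₁ × Act₂ → Act} {σ : List Pos → Act} {u : List Pos} {y x : Pos} :
    ConsistHist A proj σ (u ++ [y] ++ [x]) ↔ ConsistHist A proj σ (u ++ [y]) ∧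
      ∃ a, A.delta y a = x ∧ proj a = σ (u ++ [y]) := by
  refine ⟨fun h => ⟨h.of_isPrefix (List.prefix_append _ _), ?_⟩, fun ⟨h, a, ha, hσ⟩ j hj => ?_⟩
  · obtain ⟨a, ha, hσ⟩ := h u.length (by simp)
    refine ⟨a, by simpa using ha, ?_⟩
    rwa [List.take_left' (by simp)] at hσ
  · obtain hlt | heq : j < u.length ∨ j = u.length := by simp at hj; omega
    · have hj' : j + 1 < (u ++ [y]).length := by simp; omega
      obtain ⟨b, hb, hσ'⟩ := h j hj'
      refine ⟨b, ?_, ?_⟩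
      · rw [List.getElem_append_left hj', List.getElem_append_left (Nat.lt_of_succ_lt hj')]
        exact hb
      · rwa [List.take_append_of_le_length hj'.le]
    · subst heq
      refine ⟨a, by simpa using ha, ?_⟩
      rw [List.take_left' (by simp)]
      exact hσ

theorem ConsistHist.isChain {Act : Type*} {A : Arena Pos Act₁ Act₂ Prp}
    {proj : Act₁ × Act₂ → Act} {σ : List Pos → Act} {w : List Pos}
    (h : ConsistHist A proj σ w) : List.IsChain (arenaTS A).step w := by
  rw [List.isChain_iff_getElem]
  intro i hi
  obtain ⟨a, ha, -⟩ := h i hi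
  exact ⟨a, ha⟩

theorem consistHist_singleton {Act : Type*} (A : Arena Pos Act₁ Act₂ Prp)
    (proj : Act₁ × Act₂ → Act) (σ : List Pos → Act) (v : Pos) :
    ConsistHist A proj σ [v] := by
  intro j hj
  simp at hj

theorem length_playPrefix (ρ : ℕ → Pos) (n : ℕ) : (playPrefix ρ n).length = n := by
  simp [playPrefix]

/-- A nonempty history consistent with an Attacker strategy extends to a consistent play. -/
theorem ConsistHist.exists_play [Nonempty Act₂] {A : Arena Pos Act₁ Act₂ Prp}
    {σ : List Pos → Act₁} {w : List Pos} (h : ConsistHist A Prod.fst σ w) (hw : w ≠ []) :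
    ∃ ρ, IsPlay A ρ ∧ ConsistPlay A Prod.fst σ ρ ∧ w = playPrefix ρ w.length := by
  obtain ⟨b⟩ := ‹Nonempty Act₂›
  obtain ⟨d, -⟩ := List.exists_mem_of_ne_nil w hw
  let ext : List Pos → List Pos := fun u => u ++ [A.delta (u.getLastD d) (σ u, b)]
  let H : ℕ → List Pos := fun n => ext^[n] w
  have H_zero : H 0 = w := rfl
  have H_succ (n : ℕ) : H (n + 1) = H n ++ [A.delta ((H n).getLastD d) (σ (H n), b)] :=
    Function.iterate_succ_apply' ext n w
  have H_length (n : ℕ) : (H n).length = w.length + n := by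
    induction n with
    | zero => rfl
    | succ n ih => rw [H_succ]; simp [ih]; omega
  have H_ne (n : ℕ) : H n ≠ [] := by
    have := H_length n
    have := List.length_pos_iff.2 hw
    rw [← List.length_pos_iff]
    omega
  have H_consist (n : ℕ) : ConsistHist A Prod.fst σ (H n) := by
    induction n with
    | zero => exact h
    | succ n ih =>
      rw [H_succ]
      obtain h0 | ⟨u, y, hu⟩ := List.eq_nil_or_concat' (H n)
      · exact absurd h0 (H_ne n)
      · rw [hu] at ih ⊢
        exact consistHist_concat_concat_iff.2 ⟨ih, (σ (u ++ [y]), b), by simp, rfl⟩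
  have H_mono {m n : ℕ} (hmn : m ≤ n) : H m <+: H n := by
    induction hmn with
    | refl => exact List.prefix_rfl
    | step _ ih => exact ih.trans (by rw [H_succ]; exact List.prefix_append _ _)
  let ρ : ℕ → Pos := fun i => (H i)[i]'(by
    have := H_length i
    have := List.length_pos_iff.2 hw
    omega)
  have ρ_eq (i m : ℕ) (hi : i < (H m).length) : ρ i = (H m)[i] := by
    obtain him | hmi := le_total i m
    · exact (H_mono him).getElem _
    · exact ((H_mono hmi).getElem _).symm
  have ρ_take (n m : ℕ) (hn : n ≤ (H m).length) : playPrefix ρ n = (H m).take n := by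
    refine List.ext_getElem (by simp [length_playPrefix, hn]) fun i h₁ h₂ => ?_
    rw [length_playPrefix] at h₁
    simpa [playPrefix] using ρ_eq i m (by omega)
  have ρ_consist : ConsistPlay A Prod.fst σ ρ := fun n => by
    rw [ρ_take n n (by rw [H_length]; omega)]
    exact (H_consist n).of_isPrefix (List.take_prefix _ _)
  refine ⟨ρ, fun i => ?_, ρ_consist, ?_⟩
  · obtain ⟨a, ha, -⟩ := ρ_consist (i + 2) i (by simp [length_playPrefix])
    exact ⟨a, by simpa [playPrefix] using ha.symm⟩
  · rw [ρ_take w.length 0 (H_length 0).ge, H_zero, List.take_length]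

theorem mem_sTree_iff [Nonempty Act₂] {A : Arena Pos Act₁ Act₂ Prp} {σ : List Pos → Act₁}
    {v : Pos} {w : List Pos} :
    w ∈ STree A Prod.fst σ v ↔ w.head? = some v ∧ ConsistHist A Prod.fst σ w := by
  constructor
  · rintro ⟨⟨ρ, -, hρ, n, -, rfl⟩, ρ', -, rfl, n', hn', h⟩
    refine ⟨?_, hρ n⟩
    rw [h, playPrefix, List.head?_map, List.head?_range, if_neg (by omega)]
    rfl
  · rintro ⟨hv, hw⟩
    have hne : w ≠ [] := by rintro rfl; simp at hv
    have hpos := List.length_pos_iff.2 hne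
    obtain ⟨ρ, hplay, hρ, heq⟩ := hw.exists_play hne
    refine ⟨⟨ρ, hplay, hρ, _, hpos, heq⟩, ρ, hplay, ?_, _, hpos, heq⟩
    rw [heq, playPrefix, List.head?_map, List.head?_range, if_neg (by omega)] at hv
    exact Option.some.inj hv

theorem concat_mem_childrenOf {S : Set (List Pos)} {w : List Pos} {x : Pos}
    (h : w ++ [x] ∈ S) : w ++ [x] ∈ childrenOf S w := by
  refine ⟨h, List.prefix_append _ _, by simp, fun u _ hu hux => ?_⟩
  obtain hle | hlt := le_or_gt u.length w.length
  · exact .inl (hu.eq_of_length_le hle).symm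
  · exact .inr (hux.eq_of_length_le (by simpa using hlt))

theorem List.IsPrefix.isPrefix_dropLast {α : Type*} {u w : List α} (h : u <+: w) (hne : u ≠ w) :
    u <+: w.dropLast := by
  obtain ⟨r, rfl⟩ := h
  rw [List.dropLast_append_of_ne_nil (by rintro rfl; simp at hne)]
  exact List.prefix_append _ _

/-! ### From the strategy semantics to bounded games and back -/

theorem exists_winWithin_of_stratSem_nonempty [Nonempty Act₂] {A : Arena Pos Act₁ Act₂ Prp}
    {t : ATree Pos} (h : (stratSem A t).Nonempty) : ∃ k v, WinWithin A k v t := by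
  obtain ⟨S, ⟨σ, v, -, ⟨r, hrS, -⟩, hsub, hch⟩, hfin, -, hleaf⟩ := h
  obtain ⟨N, hN⟩ := (hfin.image List.length).bddAbove
  replace hN (w : List Pos) (hw : w ∈ S) : w.length ≤ N := hN ⟨w, hw, rfl⟩
  have main (k : ℕ) (u : List Pos) (x : Pos) (s : ATree Pos) (hk : u.length + k = N)
      (hS : u ++ [x] ∈ S) (hs : t.run u = some s) : WinWithin A k x s := by
    induction k generalizing u x s with
    | zero =>
      have := hN _ hS
      simp at this
      omega
    | succ k ih =>
      intro s' hs'
      have hrun : t.run (u ++ [x]) = some s' := by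
        rw [ATree.run_append_of_some hs, ATree.run_singleton, hs']
      have hnl : ¬ IsLeafOf S (u ++ [x]) := fun hl => by
        simp [ATree.run_eq_none_of_mem_pathSem _ (hleaf _ hl)] at hrun
      refine ⟨σ (u ++ [x]), fun a₂ => ih (u ++ [x]) _ s' (by simp; omega) ?_ hrun⟩
      obtain ⟨hhead, hcons⟩ := mem_sTree_iff.1 (hsub hS)
      have hmem : u ++ [x] ++ [A.delta x (σ (u ++ [x]), a₂)] ∈ STree A Prod.fst σ v :=
        mem_sTree_iff.2 ⟨by rw [List.head?_append, hhead]; rfl,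
          consistHist_concat_concat_iff.2 ⟨hcons, _, rfl, rfl⟩⟩
      have := concat_mem_childrenOf hmem
      rw [← hch _ hS hnl] at this
      exact this.1
  exact ⟨N, r, main N [] r t (by simp) hrS (ATree.run_nil t)⟩

theorem exists_strategy_of_winWithin [Nonempty Act₁] {A : Arena Pos Act₁ Act₂ Prp}
    {N : ℕ} {v : Pos} {t : ATree Pos} (h : WinWithin A N v t) :
    ∃ σ : List Pos → Act₁, ∀ (u : List Pos) (x : Pos) (s : ATree Pos),
      (u ++ [x]).head? = some v → ConsistHist A Prod.fst σ (u ++ [x]) → t.run u = some s →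
      WinWithin A (N - u.length) x s := by
  let good : List Pos → Act₁ → Prop := fun w a₁ => ∀ y s, w.getLast? = some y →
    t.run w = some s → ∀ a₂, WinWithin A (N - w.length) (A.delta y (a₁, a₂)) s
  let σ : List Pos → Act₁ := fun w => Classical.epsilon (good w)
  refine ⟨σ, fun u => ?_⟩
  induction u using List.reverseRecOn with
  | nil =>
    intro x s hx _ hs
    rw [ATree.run_nil] at hs
    simp only [List.nil_append, List.head?_cons, Option.some.injEq] at hx hs
    subst hx hs
    exact h
  | append_singleton u y ih =>
    intro x s hhead hcons hs
    obtain ⟨hcons', ⟨a₁, a₂⟩, rfl, ha⟩ := consistHist_concat_concat_iff.1 hcons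
    rcases hu : t.run u with _ | s₀
    · simp [ATree.run_append, hu] at hs
    have hfeed : s₀.feed y = some s := by
      rwa [ATree.run_append_of_some hu, ATree.run_singleton] at hs
    have hwin := ih y s₀ (by
      rw [List.head?_append_of_ne_nil _ (by simp)] at hhead; exact hhead) hcons' hu
    rcases hk : N - u.length with _ | k
    · rw [hk] at hwin
      exact hwin.elim
    rw [hk] at hwin
    obtain ⟨b, hb⟩ := hwin s hfeed
    have hlen : N - (u ++ [y]).length = k := by simp; omega
    have hgood : good (u ++ [y]) (σ (u ++ [y])) := by
      refine Classical.epsilon_spec (p := good (u ++ [y])) ⟨b, fun y' s' hy' hs' c => ?_⟩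
      rw [hs] at hs'
      simp only [List.getLast?_append, List.getLast?_singleton, Option.some_or,
        Option.some.injEq] at hy' hs'
      subst hy' hs'
      rw [hlen]
      exact hb c
    have := hgood y s (by simp) hs a₂
    rwa [← ha] at this

theorem exists_mem_stratSem_of_winWithin [Finite Pos] [Nonempty Act₁] [Nonempty Act₂]
    {A : Arena Pos Act₁ Act₂ Prp} {N : ℕ} {v : Pos} {t : ATree Pos} (h : WinWithin A N v t) :
    ∃ S ∈ stratSem A t, ∀ w ∈ S, w.length ≤ N := by
  obtain ⟨σ, hσ⟩ := exists_strategy_of_winWithin h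
  let S : Set (List Pos) := {w | w ∈ STree A Prod.fst σ v ∧ t.run w.dropLast ≠ none}
  have sTree_ne {w : List Pos} (hw : w ∈ STree A Prod.fst σ v) : w ≠ [] := by
    rintro rfl
    simpa using (mem_sTree_iff.1 hw).1
  have sTree_closed {w u : List Pos} (hw : w ∈ STree A Prod.fst σ v) (huw : u <+: w)
      (hu : u ≠ []) : u ∈ STree A Prod.fst σ v := by
    obtain ⟨h₁, h₂⟩ := mem_sTree_iff.1 hw
    refine mem_sTree_iff.2 ⟨?_, h₂.of_isPrefix huw⟩
    obtain ⟨r, rfl⟩ := huw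
    rwa [List.head?_append_of_ne_nil _ hu] at h₁
  have dropLast_mono {u w : List Pos} (huw : u <+: w) : u.dropLast <+: w.dropLast := by
    obtain rfl | hne := eq_or_ne u w
    · exact List.prefix_rfl
    · exact (u.dropLast_prefix).trans (huw.isPrefix_dropLast hne)
  have S_closed {w u : List Pos} (hw : w ∈ S) (huw : u <+: w) (hu : u ≠ []) : u ∈ S :=
    ⟨sTree_closed hw.1 huw hu,
      fun hn => hw.2 (ATree.run_eq_none_of_isPrefix hn (dropLast_mono huw))⟩
  have S_length {w : List Pos} (hw : w ∈ S) : w.length ≤ N := by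
    obtain h0 | ⟨u, x, rfl⟩ := List.eq_nil_or_concat' w
    · exact absurd h0 (sTree_ne hw.1)
    obtain ⟨hhead, hcons⟩ := mem_sTree_iff.1 hw.1
    obtain ⟨s, hs⟩ := Option.ne_none_iff_exists'.1 hw.2
    rw [List.dropLast_concat] at hs
    have hwin := hσ u x s hhead hcons hs
    by_contra hlt
    rw [List.length_append, List.length_singleton] at hlt
    rw [show N - u.length = 0 by omega] at hwin
    exact hwin
  have extend {u : List Pos} {x : Pos} (hw : u ++ [x] ∈ S) {s : ATree Pos}
      (hs : t.run (u ++ [x]) = some s) : ∃ y, u ++ [x] ++ [y] ∈ S := by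
    obtain ⟨b⟩ := ‹Nonempty Act₂›
    obtain ⟨hhead, hcons⟩ := mem_sTree_iff.1 hw.1
    refine ⟨A.delta x (σ (u ++ [x]), b), mem_sTree_iff.2 ⟨?_, ?_⟩, ?_⟩
    · rw [List.head?_append, hhead]
      rfl
    · exact consistHist_concat_concat_iff.2 ⟨hcons, _, rfl, rfl⟩
    · simp [hs]
  have S_root : [v] ∈ S := by
    refine ⟨mem_sTree_iff.2 ⟨rfl, consistHist_singleton _ _ _ _⟩, ?_⟩
    simp [ATree.run_nil]
  have S_isSTree : IsSTree S :=
    ⟨⟨_, S_root⟩, fun w hw => sTree_ne hw.1, fun w hw u => S_closed hw,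
      v, fun w hw => (mem_sTree_iff.1 hw.1).1⟩
  refine ⟨S, ⟨⟨σ, v, S_isSTree, ⟨v, S_root, S_root.1⟩, fun w hw => hw.1, ?_⟩, ?_, S_isSTree, ?_⟩,
    fun w => S_length⟩
  · intro w hw hnl
    have hne := sTree_ne hw.1
    have hrun : t.run w ≠ none := by
      intro hn
      refine hnl ⟨hw, fun w' hw' hpre => ?_⟩
      by_contra hne'
      exact hw'.2 (ATree.run_eq_none_of_isPrefix hn (hpre.isPrefix_dropLast (Ne.symm hne')))
    ext w'
    constructor
    · rintro ⟨hw', hpre, hne', hmin⟩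
      refine ⟨hw'.1, hpre, hne', fun w'' hw'' h₁ h₂ => hmin w'' ?_ h₁ h₂⟩
      exact S_closed hw' h₂ (sTree_ne hw'')
    · rintro ⟨hw', hpre, hne', hmin⟩
      refine ⟨⟨hw', ?_⟩, hpre, hne', fun w'' hw'' => hmin w'' hw''.1⟩
      have hpre' : w <+: w'.dropLast := hpre.isPrefix_dropLast hne'.symm
      have hne'' : w'.dropLast ≠ [] := fun h0 => hne (List.prefix_nil.1 (h0 ▸ hpre'))
      have hdrop := hmin _ (sTree_closed hw' w'.dropLast_prefix hne'') hpre' w'.dropLast_prefix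
      obtain hd | hd := hdrop
      · rwa [hd]
      · have := congrArg List.length hd
        have := List.length_pos_iff.2 (sTree_ne hw')
        simp at *
        omega
  · exact (List.finite_length_le Pos N).subset fun w => S_length
  · rintro w ⟨hw, hmax⟩
    obtain h0 | ⟨u, x, rfl⟩ := List.eq_nil_or_concat' w
    · exact absurd h0 (sTree_ne hw.1)
    refine ATree.mem_pathSem_of_first_completion _ (mem_sTree_iff.1 hw.1).2.isChain
      (by simpa using hw.2) ?_
    by_contra hn
    obtain ⟨s, hs⟩ := Option.ne_none_iff_exists'.1 hn
    obtain ⟨y, hy⟩ := extend hw hs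
    simpa using hmax _ hy (List.prefix_append _ _)

theorem stratSem_bounded_depth {Pos Act₁ Act₂ Prp : Type*}
    [Fintype Pos] [Nonempty Pos] [Finite Act₁] [Nonempty Act₁] [Finite Act₂] [Nonempty Act₂]
    (A : Arena Pos Act₁ Act₂ Prp) (t : ATree Pos) (h : (stratSem A t).Nonempty) :
    ∃ S ∈ stratSem A t, ∀ w ∈ S, w.length ≤ Fintype.card Pos * numLeaves t := by
  obtain ⟨k, v, hwin⟩ := exists_winWithin_of_stratSem_nonempty h
  exact exists_mem_stratSem_of_winWithin hwin.card_mul_numLeaves
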